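/- Let U and B be finite types, α > 0 a real number, and c : U → B → ℝ real coefficients. For θ : B → ℝ and x : U → B → ℝ call (θ, x) feasible if θ b ∈ {0,1} and x u b ∈ {0,1} for all u, b, and x u b ≤ θ b for all u, b. Then the minimum of F(θ, x) = α · ∑_{b} θ b + ∑_{u} ∑_{b} (c u b) · (x u b) over all feasible (θ, x) equals ∑_{b} min(0, α + ∑_{u} min(0, c u b)). -/

import Mathlib

/-- The objective is a sum over `b` of independent terms. -/
theorem objective_eq_sum {U B : Type*} [Fintype U] [Fintype B] (α : ℝ) (c : U → B → ℝ)
    (θ : B → ℝ) (x : U → B → ℝ) :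
    α * ∑ b, θ b + ∑ u, ∑ b, c u b * x u b = ∑ b, (α * θ b + ∑ u, c u b * x u b) := by
  rw [Finset.sum_comm, Finset.mul_sum, Finset.sum_add_distrib]

/-- Optimal-value formula for the decoupled binary program of Proposition 1:
the minimum of α·∑_b θ_b + ∑_{u,b} c_{u,b} x_{u,b} over binary (θ, x) with x_{u,b} ≤ θ_b
equals ∑_b min(0, α + ∑_u min(0, c_{u,b})). -/
theorem lagrangian_subproblem_optimal_value
    {U B : Type*} [Fintype U] [Fintype B] (α : ℝ) (hα : 0 < α) (c : U → B → ℝ) :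
    IsLeast
      {v : ℝ | ∃ θ : B → ℝ, ∃ x : U → B → ℝ,
        ((∀ b, θ b = 0 ∨ θ b = 1) ∧ (∀ u b, x u b = 0 ∨ x u b = 1) ∧
          (∀ u b, x u b ≤ θ b)) ∧
        v = α * ∑ b, θ b + ∑ u, ∑ b, c u b * x u b}
      (∑ b, min 0 (α + ∑ u, min 0 (c u b))) := by
  simp only [objective_eq_sum]
  classical
  constructor
  · refine ⟨fun b => if α + ∑ u, min 0 (c u b) ≤ 0 then 1 else 0,
      fun u b => if α + ∑ u, min 0 (c u b) ≤ 0 ∧ c u b ≤ 0 then 1 else 0, ⟨?_, ?_, ?_⟩, ?_⟩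
    · intro b
      dsimp only
      split_ifs <;> simp
    · intro u b
      dsimp only
      split_ifs <;> simp
    · intro u b
      dsimp only
      split_ifs <;> simp_all
    · refine Finset.sum_congr rfl fun b _ => ?_
      by_cases h : α + ∑ u, min 0 (c u b) ≤ 0
      · simp only [h, min_eq_right, if_true, true_and, mul_one]
        congr 1
        refine Finset.sum_congr rfl fun u _ => ?_
        split_ifs with hc
        · rw [min_eq_right hc, mul_one]
        · rw [min_eq_left (not_le.mp hc).le, mul_zero]
      · simp [h, (not_le.mp h).le]
  · rintro v ⟨θ, x, ⟨hθ, hx, hxθ⟩, rfl⟩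
    refine Finset.sum_le_sum fun b _ => ?_
    rcases hθ b with h | h
    · have hx0 : ∀ u, x u b = 0 := fun u =>
        (hx u b).resolve_right fun h1 => by linarith [hxθ u b]
      simp [h, hx0]
    · refine (min_le_right _ _).trans ?_
      rw [h, mul_one]
      gcongr with u
      rcases hx u b with h' | h' <;> simp [h']
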